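/- For a C¹-path t ↦ U_t of unitaries of the form U_t = (iI - A_t)(iI + A_t)⁻¹ with A_t self-adjoint and U₀ = I, one has exp(∫₀¹ τ[U̇_t U_t⁻¹] dt) = exp(τ[log U₁]), where log U₁ is the principal branch of the logarithm of the unitary U₁ (cut along the negative real semi-axis) defined by the Spectral Theorem. -/

import Mathlib

set_option synthInstance.maxHeartbeats 1000000
set_option maxHeartbeats 1000000

open MeasureTheory Complex

variable {H : Type*} [NormedAddCommGroup H] [InnerProductSpace ℂ H] [CompleteSpace H]

open scoped ComplexOrder in
/-- A positive linear functional on a C⋆-algebra is bounded. -/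
lemma exists_bound_of_nonneg_star_mul_self {B : Type*} [CStarAlgebra B] (φ : B →ₗ[ℂ] ℂ)
    (hφ : ∀ x, 0 ≤ (φ (star x * x)).re ∧ (φ (star x * x)).im = 0) :
    ∃ C : ℝ, ∀ x, ‖φ x‖ ≤ C * ‖x‖ := by
  let _ : PartialOrder B := CStarAlgebra.spectralOrder B
  have : StarOrderedRing B := CStarAlgebra.spectralOrderedRing B
  have hφ' : ∀ x, 0 ≤ x → 0 ≤ φ x := by
    intro x hx
    obtain ⟨y, rfl⟩ := CStarAlgebra.nonneg_iff_eq_star_mul_self.1 hx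
    exact Complex.nonneg_iff.2 ⟨(hφ y).1, (hφ y).2.symm⟩
  obtain ⟨C, hC⟩ := PositiveLinearMap.exists_norm_apply_le (PositiveLinearMap.mk₀ φ hφ')
  exact ⟨C, hC⟩

namespace VonNeumannAlgebra

lemma mem_of_commute (𝒜 : VonNeumannAlgebra H) {x : H →L[ℂ] H}
    (hx : ∀ b ∈ 𝒜.commutant, Commute x b) : x ∈ 𝒜 := by
  rw [← 𝒜.commutant_commutant, mem_commutant_iff]
  exact fun b hb => (hx b hb).symm.eq

lemma commute_of_mem_commutant (𝒜 : VonNeumannAlgebra H) {x b : H →L[ℂ] H}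
    (hx : x ∈ 𝒜) (hb : b ∈ 𝒜.commutant) : Commute x b :=
  mem_commutant_iff.1 hb x hx

lemma isClosed (𝒜 : VonNeumannAlgebra H) : IsClosed (𝒜 : Set (H →L[ℂ] H)) := by
  rw [← 𝒜.centralizer_centralizer]
  exact Set.isClosed_centralizer _

lemma cfc_mem (𝒜 : VonNeumannAlgebra H) {x : H →L[ℂ] H} (hx : x ∈ 𝒜) (f : ℂ → ℂ) :
    cfc f x ∈ 𝒜 :=
  𝒜.mem_of_commute fun _ hb => (𝒜.commute_of_mem_commutant hx hb).cfc
    (𝒜.commute_of_mem_commutant (star_mem hx) hb) f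

lemma cfc_real_mem (𝒜 : VonNeumannAlgebra H) {x : H →L[ℂ] H} (hx : x ∈ 𝒜) (f : ℝ → ℝ) :
    cfc f x ∈ 𝒜 :=
  𝒜.mem_of_commute fun _ hb => (𝒜.commute_of_mem_commutant hx hb).cfc_real f

/-- A positive linear functional on a von Neumann algebra is the restriction of a bounded
functional on all bounded operators. -/
lemma exists_continuousLinearMap_eqOn (𝒜 : VonNeumannAlgebra H) (τ : (H →L[ℂ] H) →ₗ[ℂ] ℂ)
    (hpos : ∀ a ∈ 𝒜, 0 ≤ (τ (star a * a)).re ∧ (τ (star a * a)).im = 0) :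
    ∃ T : (H →L[ℂ] H) →L[ℂ] ℂ, ∀ a ∈ 𝒜, T a = τ a := by
  have : IsClosed (𝒜.toStarSubalgebra : Set (H →L[ℂ] H)) := 𝒜.isClosed
  let φ : 𝒜.toStarSubalgebra →ₗ[ℂ] ℂ := τ ∘ₗ 𝒜.toStarSubalgebra.toSubalgebra.toSubmodule.subtype
  obtain ⟨C, hC⟩ := exists_bound_of_nonneg_star_mul_self φ fun x => hpos x x.2
  obtain ⟨T, hT, -⟩ := exists_extension_norm_eq (𝕜 := ℂ)
    𝒜.toStarSubalgebra.toSubalgebra.toSubmodule (LinearMap.mkContinuous φ C hC)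
  exact ⟨T, fun a ha => hT ⟨a, ha⟩⟩

end VonNeumannAlgebra

section Trace

open Polynomial

variable {B : Type*} [CStarAlgebra B]

lemma exists_polynomial_derivative_eq (q : ℝ[X]) : ∃ p : ℝ[X], derivative p = q := by
  induction q using Polynomial.induction_on' with
  | add p q hp hq =>
    obtain ⟨P, rfl⟩ := hp
    obtain ⟨Q, rfl⟩ := hq
    exact ⟨P + Q, derivative_add⟩
  | monomial n a =>
    refine ⟨monomial (n + 1) (a / (n + 1)), ?_⟩
    rw [derivative_monomial]
    simp [div_mul_cancel₀ a (Nat.cast_add_one_ne_zero n)]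

/-- A function with continuous derivative is approximated by polynomials, together with its
derivative, uniformly on compact intervals. -/
lemma exists_polynomial_near_deriv {f f' : ℝ → ℝ} (hf : ∀ x, HasDerivAt f (f' x) x)
    (hf' : Continuous f') {M : ℝ} (hM : 0 ≤ M) {ε : ℝ} (hε : 0 < ε) :
    ∃ p : ℝ[X], ∀ x ∈ Set.Icc (-M) M,
      |p.eval x - f x| ≤ ε ∧ |(derivative p).eval x - f' x| ≤ ε := by
  have hδ : 0 < ε / (M + 1) := by positivity
  obtain ⟨q, hq⟩ := exists_polynomial_near_of_continuousOn (-M) M f' hf'.continuousOn _ hδ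
  obtain ⟨p, rfl⟩ := exists_polynomial_derivative_eq q
  refine ⟨p - C (p.eval 0 - f 0), fun x hx => ⟨?_, ?_⟩⟩
  · have h := (convex_Icc (-M) M).norm_image_sub_le_of_norm_hasDerivWithin_le
      (f := fun y => p.eval y - f y) (C := ε / (M + 1))
      (fun y _ => ((p.hasDerivAt y).sub (hf y)).hasDerivWithinAt)
      (fun y hy => (hq y hy).le) (x := 0) (y := x) (by simpa using hM) hx
    have hx' : |x| ≤ M := abs_le.2 hx
    rw [Real.norm_eq_abs, Real.norm_eq_abs, sub_zero] at h
    simp only [eval_sub, eval_C]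
    calc |p.eval x - (p.eval 0 - f 0) - f x| = |p.eval x - f x - (p.eval 0 - f 0)| := by
          congr 1; ring
      _ ≤ ε / (M + 1) * |x| := h
      _ ≤ ε / (M + 1) * (M + 1) := by gcongr; linarith
      _ = ε := by field_simp
  · simp only [derivative_sub, derivative_C, sub_zero]
    exact (hq x hx).le.trans (div_le_self hε.le (by linarith))

lemma hasDerivAt_trace_aeval (S : Subalgebra ℂ B) (T : B →L[ℂ] ℂ)
    (htr : ∀ a ∈ S, ∀ b ∈ S, T (a * b) = T (b * a)) {A : ℝ → B} {A' : B} {t : ℝ}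
    (h : HasDerivAt A A' t) (hA : A t ∈ S) (hA' : A' ∈ S) (p : ℝ[X]) :
    HasDerivAt (fun s => T (aeval (A s) p)) (T (aeval (A t) (derivative p) * A')) t := by
  induction p using Polynomial.induction_on' with
  | add p q hp hq => 
    simp only [map_add, add_mul]
    exact hp.add hq
  | monomial n r =>
    have key : ∀ i ∈ Finset.range n,
        T (A t ^ (n.pred - i) * A' * A t ^ i) = T (A t ^ (n - 1) * A') := by
      intro i hi
      rw [Finset.mem_range] at hi
      rw [mul_assoc, htr _ (pow_mem hA _) _ (mul_mem hA' (pow_mem hA _)), mul_assoc, ← pow_add,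
        htr _ hA' _ (pow_mem hA _)]
      congr 3
      simp only [Nat.pred_eq_sub_one]
      omega
    have h1 := ((T.restrictScalars ℝ).hasFDerivAt.comp_hasDerivAt t
      (h.fun_pow' n)).const_smul r
    simp only [ContinuousLinearMap.coe_restrictScalars', map_sum, Finset.sum_congr rfl key,
      Finset.sum_const, Finset.card_range] at h1
    have h2 : (fun s => T (aeval (A s) (monomial n r))) = r • (T ∘ fun x => A x ^ n) := by
      ext s
      simp [aeval_monomial, ← Algebra.smul_def]
    have h3 : T (aeval (A t) (derivative (monomial n r)) * A') =
        r • n • T (A t ^ (n - 1) * A') := by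
      rw [derivative_monomial, aeval_monomial, ← Algebra.smul_def, smul_mul_assoc, mul_smul,
        Nat.cast_smul_eq_nsmul, T.map_smul_of_tower, map_nsmul]
    rw [h2, h3]
    exact h1

lemma hasDerivAt_mem_of_isClosed {E : Type*} [NormedAddCommGroup E] [NormedSpace ℝ E]
    {S : Submodule ℝ E} (hS : IsClosed (S : Set E)) {A : ℝ → E} {A' : E} {a b t : ℝ} (hab : a < b)
    (ht : t ∈ Set.Icc a b) (hA : ∀ s ∈ Set.Icc a b, A s ∈ S) (h : HasDerivAt A A' t) : A' ∈ S := by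
  rw [← h.hasDerivWithinAt.derivWithin (uniqueDiffOn_Icc hab t ht)]
  have h1 := range_derivWithin_subset_closure_span_image A (s := Set.Icc a b) (t := Set.Icc a b)
    (by rw [Set.inter_self]; exact subset_closure) (Set.mem_range_self t)
  have h2 : Submodule.span ℝ (A '' Set.Icc a b) ≤ S := by
    rw [Submodule.span_le]
    rintro _ ⟨s, hs, rfl⟩
    exact hA s hs
  exact closure_minimal h2 hS h1

/-- Under a tracial functional, the fundamental theorem of calculus holds for the continuous
functional calculus along a path of self-adjoint elements. -/
lemma integral_trace_cfc_deriv (S : Subalgebra ℂ B) (hS : IsClosed (S : Set B)) (T : B →L[ℂ] ℂ)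
    (htr : ∀ a ∈ S, ∀ b ∈ S, T (a * b) = T (b * a)) {A : ℝ → B} (hA : ContDiff ℝ 1 A) {a b : ℝ}
    (hab : a < b) (hmem : ∀ t ∈ Set.Icc a b, A t ∈ S)
    (hsa : ∀ t ∈ Set.Icc a b, IsSelfAdjoint (A t)) {f f' : ℝ → ℝ}
    (hf : ∀ x, HasDerivAt f (f' x) x) (hf' : Continuous f') :
    ∫ t in a..b, T (cfc f' (A t) * deriv A t) = T (cfc f (A b)) - T (cfc f (A a)) := by
  have hAd : ∀ t, HasDerivAt A (deriv A t) t := fun t =>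
    (hA.differentiable one_ne_zero t).hasDerivAt
  have hdc : Continuous (deriv A) := hA.continuous_deriv_one
  have hfc : Continuous f := continuous_iff_continuousAt.2 fun x => (hf x).continuousAt
  have hdmem : ∀ t ∈ Set.Icc a b, deriv A t ∈ S := fun t ht =>
    hasDerivAt_mem_of_isClosed (S := S.toSubmodule.restrictScalars ℝ) hS hab ht hmem (hAd t)
  obtain ⟨M, hM⟩ := isCompact_Icc.exists_bound_of_continuousOn (hA.continuous.continuousOn
    (s := Set.Icc a b))
  obtain ⟨D, hD⟩ := isCompact_Icc.exists_bound_of_continuousOn (hdc.continuousOn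
    (s := Set.Icc a b))
  have hM0 : 0 ≤ M := (norm_nonneg _).trans (hM a (Set.left_mem_Icc.2 hab.le))
  have hD0 : 0 ≤ D := (norm_nonneg _).trans (hD a (Set.left_mem_Icc.2 hab.le))
  have hspec : ∀ t ∈ Set.Icc a b, spectrum ℝ (A t) ⊆ Set.Icc (-M) M := fun t ht x hx => by
    cases subsingleton_or_nontrivial B
    · simp at hx
    · exact abs_le.1 ((spectrum.norm_le_norm_of_mem hx).trans (hM t ht))
  have hcont : ∀ g : ℝ → ℝ, Continuous g →
      IntervalIntegrable (fun t => T (cfc g (A t) * deriv A t)) volume a b := fun g hg => by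
    refine ContinuousOn.intervalIntegrable ?_
    rw [Set.uIcc_of_le hab.le]
    exact T.continuous.comp_continuousOn ((ContinuousOn.cfc' isCompact_Icc g
      hA.continuous.continuousOn hspec hsa hg.continuousOn).mul hdc.continuousOn)
  have hpoly : ∀ p : ℝ[X], ∫ t in a..b, T (cfc (derivative p).eval (A t) * deriv A t) =
      T (cfc p.eval (A b)) - T (cfc p.eval (A a)) := fun p => by
    rw [cfc_polynomial p (A b) (hsa b (Set.right_mem_Icc.2 hab.le)),
      cfc_polynomial p (A a) (hsa a (Set.left_mem_Icc.2 hab.le)),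
      intervalIntegral.integral_eq_sub_of_hasDerivAt (f := fun s => T (aeval (A s) p)) ?_
        (hcont _ (derivative p).continuous)]
    intro t ht
    rw [Set.uIcc_of_le hab.le] at ht
    rw [cfc_polynomial _ (A t) (hsa t ht)]
    exact hasDerivAt_trace_aeval S T htr (hAd t) (hmem t ht) (hdmem t ht) p
  refine eq_of_forall_dist_le fun ε hε => ?_
  have hK : 0 ≤ ‖T‖ * D * (b - a) + ‖T‖ + ‖T‖ := by
    have := sub_nonneg.2 hab.le
    positivity
  set K := ‖T‖ * D * (b - a) + ‖T‖ + ‖T‖ with hKdef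
  set δ := ε / (K + 1) with hδdef
  have hδ : 0 < δ := by positivity
  obtain ⟨p, hp⟩ := exists_polynomial_near_deriv hf hf' hM0 hδ
  have hdist : ∀ g h : ℝ → ℝ, Continuous g → Continuous h →
      (∀ x ∈ Set.Icc (-M) M, |g x - h x| ≤ δ) → ∀ t ∈ Set.Icc a b,
      ‖cfc g (A t) - cfc h (A t)‖ ≤ δ := fun g h hg hh hgh t ht => by
    rw [← cfc_sub g h (A t) hg.continuousOn hh.continuousOn]
    exact norm_cfc_le hδ.le fun x hx => hgh x (hspec t ht hx)
  have hend : ∀ t ∈ Set.Icc a b, ‖T (cfc p.eval (A t)) - T (cfc f (A t))‖ ≤ ‖T‖ * δ :=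
    fun t ht => by
      rw [← map_sub]
      exact T.le_opNorm_of_le (hdist _ _ p.continuous hfc (fun x hx => (hp x hx).1) t ht)
  have hint : ‖(∫ t in a..b, T (cfc (derivative p).eval (A t) * deriv A t)) -
      ∫ t in a..b, T (cfc f' (A t) * deriv A t)‖ ≤ ‖T‖ * (δ * D) * (b - a) := by
    rw [← intervalIntegral.integral_sub (hcont _ (derivative p).continuous) (hcont _ hf')]
    refine (intervalIntegral.norm_integral_le_of_norm_le_const fun t ht => ?_).trans_eq
      (by rw [abs_of_nonneg (sub_nonneg.2 hab.le)])
    rw [Set.uIoc_of_le hab.le] at ht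
    have ht' := Set.Ioc_subset_Icc_self ht
    rw [← map_sub, ← sub_mul]
    refine T.le_opNorm_of_le ((norm_mul_le _ _).trans ?_)
    exact mul_le_mul (hdist _ _ (derivative p).continuous hf' (fun x hx => (hp x hx).2) t ht')
      (hD t ht') (norm_nonneg _) hδ.le
  rw [hpoly p] at hint
  have ha := hend a (Set.left_mem_Icc.2 hab.le)
  have hb := hend b (Set.right_mem_Icc.2 hab.le)
  rw [dist_eq_norm]
  set I := ∫ t in a..b, T (cfc f' (A t) * deriv A t)
  calc ‖I - (T (cfc f (A b)) - T (cfc f (A a)))‖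
      = ‖(T (cfc p.eval (A b)) - T (cfc f (A b))) -
          (T (cfc p.eval (A b)) - T (cfc p.eval (A a)) - I) -
          (T (cfc p.eval (A a)) - T (cfc f (A a)))‖ := by congr 1; ring
    _ ≤ ‖T‖ * δ + ‖T‖ * (δ * D) * (b - a) + ‖T‖ * δ :=
        norm_sub_le_of_le (norm_sub_le_of_le hb hint) ha
    _ = K * δ := by rw [hKdef]; ring
    _ ≤ (K + 1) * δ := by gcongr; linarith
    _ = ε := by rw [hδdef]; field_simp

end Trace

section Cayley

variable {B : Type*} [CStarAlgebra B]

lemma IsSelfAdjoint.I_add_ne_zero {a : B} (ha : IsSelfAdjoint a) {z : ℂ} (hz : z ∈ spectrum ℂ a) :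
    I + z ≠ 0 := by
  rw [ha.mem_spectrum_eq_re hz]
  intro h
  simpa using congrArg Complex.im h

lemma IsSelfAdjoint.I_sub_ne_zero {a : B} (ha : IsSelfAdjoint a) {z : ℂ} (hz : z ∈ spectrum ℂ a) :
    I - z ≠ 0 := by
  rw [ha.mem_spectrum_eq_re hz]
  intro h
  simpa using congrArg Complex.im h

lemma cfc_I_add {a : B} (ha : IsSelfAdjoint a) : cfc (fun z : ℂ => I + z) a = I • 1 + a := by
  have := ha.isStarNormal
  rw [cfc_const_add I (fun z => z) a, cfc_id' ℂ a, Algebra.algebraMap_eq_smul_one]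

lemma cfc_I_sub {a : B} (ha : IsSelfAdjoint a) : cfc (fun z : ℂ => I - z) a = I • 1 - a := by
  have := ha.isStarNormal
  rw [cfc_sub (fun _ => I) (fun z => z) a, cfc_const I a, cfc_id' ℂ a,
    Algebra.algebraMap_eq_smul_one]

lemma isUnit_I_smul_one_add {a : B} (ha : IsSelfAdjoint a) : IsUnit (I • 1 + a) := by
  have := ha.isStarNormal
  rw [← cfc_I_add ha, isUnit_cfc_iff (fun z : ℂ => I + z) a]
  exact fun z hz => ha.I_add_ne_zero hz

lemma ringInverse_I_smul_one_add {a : B} (ha : IsSelfAdjoint a) :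
    Ring.inverse (I • 1 + a) = cfc (fun z : ℂ => (I + z)⁻¹) a := by
  have := ha.isStarNormal
  rw [← cfc_I_add ha, cfc_inv (fun z : ℂ => I + z) a fun z hz => ha.I_add_ne_zero hz]

lemma continuousOn_inv_I_add {a : B} (ha : IsSelfAdjoint a) :
    ContinuousOn (fun z : ℂ => (I + z)⁻¹) (spectrum ℂ a) :=
  (by fun_prop : ContinuousOn (fun z : ℂ => I + z) _).inv₀ fun _ hz => ha.I_add_ne_zero hz

lemma continuousOn_cayley {a : B} (ha : IsSelfAdjoint a) :
    ContinuousOn (fun z : ℂ => (I - z) * (I + z)⁻¹) (spectrum ℂ a) :=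
  (by fun_prop : ContinuousOn (fun z : ℂ => I - z) _).mul (continuousOn_inv_I_add ha)

lemma cayley_eq_cfc {a : B} (ha : IsSelfAdjoint a) :
    (I • 1 - a) * Ring.inverse (I • 1 + a) = cfc (fun z : ℂ => (I - z) * (I + z)⁻¹) a := by
  rw [ringInverse_I_smul_one_add ha, ← cfc_I_sub ha,
    cfc_mul _ _ a (by fun_prop) (continuousOn_inv_I_add ha)]

lemma ringInverse_cayley_eq_cfc {a : B} (ha : IsSelfAdjoint a) :
    Ring.inverse ((I • 1 - a) * Ring.inverse (I • 1 + a)) =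
      cfc (fun z : ℂ => ((I - z) * (I + z)⁻¹)⁻¹) a := by
  have := ha.isStarNormal
  rw [cayley_eq_cfc ha, cfc_inv _ a _ (continuousOn_cayley ha)]
  exact fun z hz => mul_ne_zero (ha.I_sub_ne_zero hz) (inv_ne_zero (ha.I_add_ne_zero hz))

lemma cayley_ofReal (x : ℝ) : (I - x) * (I + x)⁻¹ = (1 + x * I) / (1 - x * I) := by
  have h1 : I + (x : ℂ) ≠ 0 := fun h => by simpa using congrArg Complex.im h
  have h2 : 1 - (x : ℂ) * I ≠ 0 := fun h => by simpa using congrArg Complex.re h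
  rw [eq_div_iff h2, mul_right_comm, ← div_eq_mul_inv, div_eq_iff h1]
  linear_combination (-2 * (x : ℂ)) * I_sq

lemma cayley_ofReal_mem_slitPlane (x : ℝ) : (I - x) * (I + x)⁻¹ ∈ slitPlane := by
  rw [mem_slitPlane_iff]
  rcases eq_or_ne x 0 with rfl | hx
  · simp
  · right
    have h : ((I - x) * (I + x)⁻¹).im = 2 * x / (x * x + 1) := by
      simp only [mul_im, sub_re, sub_im, inv_re, inv_im, add_re, add_im, I_re, I_im, ofReal_re,
        ofReal_im, normSq_apply]
      ring
    rw [h]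
    exact div_ne_zero (mul_ne_zero two_ne_zero hx)
      (add_pos_of_nonneg_of_pos (mul_self_nonneg x) one_pos).ne'

lemma log_cayley_ofReal (x : ℝ) : log ((I - x) * (I + x)⁻¹) = 2 * I * Real.arctan x := by
  rw [cayley_ofReal, ofReal_arctan, Complex.arctan]
  linear_combination log ((1 + x * I) / (1 - x * I)) * I_sq

/-- The principal logarithm of the Cayley transform. -/
lemma cfc_log_cayley {a : B} (ha : IsSelfAdjoint a) :
    cfc (fun z : ℂ => log z) ((I • 1 - a) * Ring.inverse (I • 1 + a)) =
      (2 * I) • cfc Real.arctan a := by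
  have := ha.isStarNormal
  rw [cayley_eq_cfc ha, ← cfc_comp' (fun z : ℂ => log z) (fun z : ℂ => (I - z) * (I + z)⁻¹) a ?_
    (continuousOn_cayley ha), cfc_real_eq_complex Real.arctan ha,
    ← cfc_const_mul (2 * I) (fun z : ℂ => (Real.arctan z.re : ℂ)) a (by fun_prop)]
  · refine cfc_congr fun z hz => ?_
    rw [ha.mem_spectrum_eq_re hz, ofReal_re, log_cayley_ofReal]
  · rintro _ ⟨z, hz, rfl⟩
    refine (continuousAt_clog ?_).continuousWithinAt
    rw [ha.mem_spectrum_eq_re hz]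
    exact cayley_ofReal_mem_slitPlane z.re

lemma hasDerivAt_cayley {A : ℝ → B} {A' : B} {t : ℝ} (hA : HasDerivAt A A' t)
    (ha : IsSelfAdjoint (A t)) :
    HasDerivAt (fun s => (I • 1 - A s) * Ring.inverse (I • 1 + A s))
      (-(A' * Ring.inverse (I • 1 + A t)) - (I • 1 - A t) *
        (Ring.inverse (I • 1 + A t) * A' * Ring.inverse (I • 1 + A t))) t := by
  obtain ⟨u, hu⟩ := isUnit_I_smul_one_add ha
  have h1 : HasDerivAt (fun s => I • 1 + A s) A' t := hA.const_add _
  have h2 := (hu ▸ hasFDerivAt_ringInverse (𝕜 := ℝ) u).comp_hasDerivAt t h1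
  refine ((hA.const_sub (I • 1)).mul h2).congr_deriv ?_
  simp [← hu, sub_eq_add_neg]

lemma trace_logDeriv_cayley (S : Subalgebra ℂ B) (T : B →L[ℂ] ℂ)
    (htr : ∀ a ∈ S, ∀ b ∈ S, T (a * b) = T (b * a)) {a d : B} (ha : IsSelfAdjoint a)
    (hS : ∀ f : ℂ → ℂ, cfc f a ∈ S) (hd : d ∈ S) :
    T ((-(d * Ring.inverse (I • 1 + a)) - (I • 1 - a) *
        (Ring.inverse (I • 1 + a) * d * Ring.inverse (I • 1 + a))) *
        Ring.inverse ((I • 1 - a) * Ring.inverse (I • 1 + a))) =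
      2 * I * T (cfc (fun x : ℝ => 1 / (1 + x ^ 2)) a * d) := by
  have := ha.isStarNormal
  have hc1 := continuousOn_inv_I_add ha
  have hc2 : ContinuousOn (fun z : ℂ => ((I - z) * (I + z)⁻¹)⁻¹) (spectrum ℂ a) :=
    (continuousOn_cayley ha).inv₀ fun z hz =>
      mul_ne_zero (ha.I_sub_ne_zero hz) (inv_ne_zero (ha.I_add_ne_zero hz))
  have hc3 : ContinuousOn (fun z : ℂ => I - z) (spectrum ℂ a) := by fun_prop
  have hc4 : ContinuousOn (fun z : ℂ => (I + z)⁻¹ * ((I - z) * (I + z)⁻¹)⁻¹) (spectrum ℂ a) :=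
    hc1.mul hc2
  have hc5 := continuousOn_cayley ha
  have hc6 : ContinuousOn (fun z : ℂ => (I + z)⁻¹ * ((I - z) * (I + z)⁻¹)⁻¹ *
      ((I - z) * (I + z)⁻¹)) (spectrum ℂ a) := hc4.mul hc5
  rw [ringInverse_cayley_eq_cfc ha, ringInverse_I_smul_one_add ha, ← cfc_I_sub ha]
  set R := cfc (fun z : ℂ => (I + z)⁻¹) a with hR
  set V := cfc (fun z : ℂ => ((I - z) * (I + z)⁻¹)⁻¹) a with hV
  set M := cfc (fun z : ℂ => I - z) a with hM
  have key : R * V + R * V * (M * R) = (-(2 * I)) • cfc (fun x : ℝ => 1 / (1 + x ^ 2)) a := by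
    rw [cfc_real_eq_complex _ ha, ← cfc_const_mul (-(2 * I)) _ a ?_, hR, hV, hM,
      ← cfc_mul _ _ a hc1 hc2, ← cfc_mul _ _ a hc3 hc1,
      ← cfc_mul _ _ a hc4 hc5, ← cfc_add a _ _ hc4 hc6]
    · refine cfc_congr fun z hz => ?_
      have h1 := ha.I_add_ne_zero hz
      have h2 := ha.I_sub_ne_zero hz
      have h3 : (1 : ℂ) + z ^ 2 ≠ 0 := by
        have : (1 : ℂ) + z ^ 2 = -((I + z) * (I - z)) := by linear_combination I_sq
        rw [this]
        exact neg_ne_zero.2 (mul_ne_zero h1 h2)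
      have hz' := (ha.mem_spectrum_eq_re hz).symm
      simp only [ofReal_div, ofReal_add, ofReal_pow, ofReal_one, hz']
      field_simp
      linear_combination (2 * I) * I_sq
    · refine Continuous.continuousOn (continuous_ofReal.comp ?_)
      refine continuous_const.div (by fun_prop) fun z => by positivity
  have hRS : R ∈ S := hS _
  have hVS : V ∈ S := hS _
  have hMS : M ∈ S := hS _
  have e1 : T (d * R * V) = T (R * V * d) := by
    rw [mul_assoc, htr _ hd _ (mul_mem hRS hVS)]
  have e2 : T (M * (R * d * R) * V) = T (R * V * (M * R) * d) := by
    rw [show M * (R * d * R) * V = (M * R * d) * (R * V) by simp only [mul_assoc],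
      htr _ (mul_mem (mul_mem hMS hRS) hd) _ (mul_mem hRS hVS)]
    simp only [mul_assoc]
  rw [sub_mul, neg_mul, map_sub, map_neg, e1, e2]
  have e3 := congrArg (fun x => T (x * d)) key
  simp only [add_mul, map_add, smul_mul_assoc, map_smul, smul_eq_mul] at e3
  linear_combination -e3

end Cayley

/-- For a C¹-path `t ↦ U_t` of unitaries of the form `U_t = (iI - A_t)(iI + A_t)⁻¹`
with `A_t` self-adjoint, `A₀ = 0` (so `U₀ = I`), in a finite von Neumann algebra `𝒜`
with tracial state `τ`, one has `exp(∫₀¹ τ[U̇_t U_t⁻¹] dt) = exp(τ[log U₁])`, where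
`log U₁` is the principal branch of the logarithm of the unitary `U₁` (cut along the
negative real semi-axis, `arg ∈ (-π, π]`) defined via the functional calculus. -/
theorem deLaHarpeSkandalis_unitary_path (𝒜 : VonNeumannAlgebra H)
    (τ : (H →L[ℂ] H) →ₗ[ℂ] ℂ)
    (htr : ∀ a ∈ 𝒜, ∀ b ∈ 𝒜, τ (a * b) = τ (b * a))
    (hpos : ∀ a ∈ 𝒜, 0 ≤ (τ (star a * a)).re ∧ (τ (star a * a)).im = 0)
    (hone : τ 1 = 1)
    (A : ℝ → H →L[ℂ] H)
    (hmem : ∀ t ∈ Set.Icc (0 : ℝ) 1, A t ∈ 𝒜)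
    (hsa : ∀ t ∈ Set.Icc (0 : ℝ) 1, IsSelfAdjoint (A t))
    (hsmooth : ContDiff ℝ 1 A)
    (h0 : A 0 = 0) :
    Complex.exp (∫ t in (0 : ℝ)..1,
        τ (deriv (fun s : ℝ =>
              (Complex.I • 1 - A s) * Ring.inverse (Complex.I • 1 + A s)) t *
            Ring.inverse ((Complex.I • 1 - A t) * Ring.inverse (Complex.I • 1 + A t)))) =
      Complex.exp (τ (cfc (fun z : ℂ => Complex.log z)
        ((Complex.I • 1 - A 1) * Ring.inverse (Complex.I • 1 + A 1)))) := by
  obtain ⟨T, hT⟩ := 𝒜.exists_continuousLinearMap_eqOn τ hpos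
  let S : Subalgebra ℂ (H →L[ℂ] H) := 𝒜.toStarSubalgebra.toSubalgebra
  have hS : IsClosed (S : Set (H →L[ℂ] H)) := 𝒜.isClosed
  have hTtr : ∀ a ∈ S, ∀ b ∈ S, T (a * b) = T (b * a) := fun a ha b hb => by
    rw [hT _ (mul_mem (S := VonNeumannAlgebra H) ha hb),
      hT _ (mul_mem (S := VonNeumannAlgebra H) hb ha), htr a ha b hb]
  have hd : ∀ t, HasDerivAt A (deriv A t) t := fun t =>
    (hsmooth.differentiable one_ne_zero t).hasDerivAt
  have hdS : ∀ t ∈ Set.Icc (0 : ℝ) 1, deriv A t ∈ S := fun t ht =>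
    hasDerivAt_mem_of_isClosed (S := S.toSubmodule.restrictScalars ℝ) hS one_pos ht hmem (hd t)
  have hint := integral_trace_cfc_deriv S hS T hTtr hsmooth one_pos hmem hsa
    Real.hasDerivAt_arctan (continuous_const.div (by fun_prop) fun x => by positivity)
  have h1 : (1 : ℝ) ∈ Set.Icc (0 : ℝ) 1 := Set.right_mem_Icc.2 zero_le_one
  rw [h0, cfc_apply_zero, Real.arctan_zero, map_zero, map_zero, sub_zero] at hint
  rw [cfc_log_cayley (hsa 1 h1), map_smul, ← hT _ (𝒜.cfc_real_mem (hmem 1 h1) _), ← hint,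
    smul_eq_mul, ← intervalIntegral.integral_const_mul]
  congr 1
  refine intervalIntegral.integral_congr fun t ht => ?_
  rw [Set.uIcc_of_le zero_le_one] at ht
  have hcfc : ∀ f : ℂ → ℂ, cfc f (A t) ∈ S := fun f => 𝒜.cfc_mem (hmem t ht) f
  rw [(hasDerivAt_cayley (hd t) (hsa t ht)).deriv,
    ← trace_logDeriv_cayley S T hTtr (hsa t ht) hcfc (hdS t ht)]
  refine (hT _ ?_).symm
  rw [ringInverse_cayley_eq_cfc (hsa t ht), ringInverse_I_smul_one_add (hsa t ht),
    ← cfc_I_sub (hsa t ht)]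
  exact S.mul_mem (S.sub_mem (S.neg_mem (S.mul_mem (hdS t ht) (hcfc _)))
    (S.mul_mem (hcfc _) (S.mul_mem (S.mul_mem (hcfc _) (hdS t ht)) (hcfc _)))) (hcfc _)
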